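/- There exist constants η ≥ 1 and C > 0 such that for every δ ∈ M and every v ∈ V, writing s = s(δ), one has e^{⟨s,v⟩} ≥ C κ(s) · dist(δ, ∂M)^η, where dist(δ, ∂M) is the Euclidean distance from δ to the boundary of M. -/

import Mathlib

open scoped RealInnerProductSpace
open Finset

lemma aux_grad {E : Type*} [NormedAddCommGroup E] [InnerProductSpace ℝ E]
    [FiniteDimensional ℝ E] (V : Finset E) (c : E → ℝ) (κ : E → ℝ)
    (hκ : ∀ x, κ x = ∑ v ∈ V, c v * Real.exp ⟪x, v⟫) (x : E) (hpos : 0 < κ x) :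
    gradient (fun x => Real.log (κ x)) x
      = ∑ v ∈ V, (c v * Real.exp ⟪x, v⟫ / κ x) • v := by
  apply HasGradientAt.gradient
  rw [hasGradientAt_iff_hasFDerivAt]
  have h1 : HasFDerivAt κ
      (∑ v ∈ V, c v • (Real.exp ⟪x, v⟫ • (innerSL ℝ v : E →L[ℝ] ℝ))) x := by
    have : κ = fun x => ∑ v ∈ V, c v * Real.exp ⟪x, v⟫ := funext hκ
    rw [this]
    apply HasFDerivAt.fun_sum
    intro v _
    apply HasFDerivAt.const_mul
    apply HasFDerivAt.exp
    have h := (innerSL ℝ v : E →L[ℝ] ℝ).hasFDerivAt (x := x)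
    refine h.congr_of_eventuallyEq (Filter.Eventually.of_forall fun y => ?_)
    simp [real_inner_comm]
  have h2 := h1.log hpos.ne'
  refine h2.congr_fderiv ?_
  symm
  ext y
  rw [InnerProductSpace.toDual_apply_apply, sum_inner]
  simp only [ContinuousLinearMap.smul_apply, ContinuousLinearMap.sum_apply, smul_eq_mul,
    Finset.mul_sum, innerSL_apply_apply, real_inner_smul_left]
  refine Finset.sum_congr rfl fun v _ => ?_
  ring

lemma aux_K {E : Type*} [NormedAddCommGroup E] [InnerProductSpace ℝ E]
    (V : Finset E) (A : Finset E) :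
    ∃ K : ℝ, 0 ≤ K ∧ ((convexHull ℝ (A : Set E) ∩ interior (convexHull ℝ (V : Set E))).Nonempty →
      ∀ x : E, ∀ v ∈ V, ∀ m τ : ℝ, (∀ w ∈ V, ⟪x, w⟫ ≤ m) → (∀ w ∈ A, m - ⟪x, w⟫ ≤ τ) →
        m - ⟪x, v⟫ ≤ K * τ) := by
  by_cases hne : (convexHull ℝ (A : Set E) ∩ interior (convexHull ℝ (V : Set E))).Nonempty
  swap
  · exact ⟨0, le_rfl, fun h => absurd h hne⟩
  obtain ⟨b, hbA, hbM⟩ := hne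
  have hev : ∀ v ∈ V, ∀ᶠ ε in nhdsWithin (0:ℝ) (Set.Ioi 0),
      b + ε • (b - v) ∈ convexHull ℝ (V : Set E) := by
    intro v _
    have hcont : Continuous fun ε : ℝ => b + ε • (b - v) := by fun_prop
    have := hcont.continuousAt (x := 0)
    have h2 : ∀ᶠ y in nhds (b + (0:ℝ) • (b - v)), y ∈ convexHull ℝ (V : Set E) := by
      simpa using mem_interior_iff_mem_nhds.1 hbM
    exact (this.eventually h2).filter_mono nhdsWithin_le_nhds
  have hev2 := (Finset.eventually_all V).2 hev
  obtain ⟨ε, hε, hε0⟩ := (hev2.and self_mem_nhdsWithin).exists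
  have hε0 : 0 < ε := hε0
  refine ⟨1 + 1/ε, by positivity, fun _ x v hv m τ hm hA => ?_⟩
  have h1 : ∀ y ∈ convexHull ℝ (V : Set E), ⟪x, y⟫ ≤ m := by
    intro y hy
    have : convexHull ℝ (V : Set E) ⊆ {y | innerSL ℝ x y ≤ m} :=
      convexHull_min (fun w hw => by simpa using hm w hw)
        (convex_halfSpace_le (innerSL ℝ x : E →L[ℝ] ℝ).isLinear m)
    simpa using this hy
  have h2 : m - τ ≤ ⟪x, b⟫ := by
    have : convexHull ℝ (A : Set E) ⊆ {y | m - τ ≤ innerSL ℝ x y} :=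
      convexHull_min (fun w hw => by
          have := hA w hw
          simp; linarith)
        (convex_halfSpace_ge (innerSL ℝ x : E →L[ℝ] ℝ).isLinear (m - τ))
    simpa using this hbA
  have h3 := h1 _ (hε v hv)
  rw [inner_add_right, inner_smul_right, inner_sub_right] at h3
  have h4 : ⟪x, b⟫ - ⟪x, v⟫ ≤ τ / ε := by
    rw [le_div_iff₀ hε0]; linarith
  have : (1 + 1/ε) * τ = τ + τ/ε := by ring
  linarith

/-- There exist constants `η ≥ 1` and `C > 0` such that for every `δ ∈ M` and
every `v ∈ V`, writing `s = s δ` for the unique point with `∇ log κ (s) = δ`, one has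
`e^{⟪s, v⟫} ≥ C * κ s * dist(δ, ∂M)^η`. -/
theorem statement5 {E : Type*} [NormedAddCommGroup E] [InnerProductSpace ℝ E]
    [FiniteDimensional ℝ E]
    (V : Finset E) (hspan : Submodule.span ℝ (V : Set E) = ⊤)
    (c : E → ℝ) (hc : ∀ v ∈ V, 0 < c v) (hcsum : ∑ v ∈ V, c v = 1)
    (κ : E → ℝ) (hκ : ∀ x, κ x = ∑ v ∈ V, c v * Real.exp ⟪x, v⟫)
    (M : Set E) (hM : M = interior (convexHull ℝ (V : Set E)))
    (s : E → E) (hs : ∀ δ ∈ M, gradient (fun x => Real.log (κ x)) (s δ) = δ) :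
    ∃ η : ℝ, 1 ≤ η ∧ ∃ C > (0 : ℝ), ∀ δ ∈ M, ∀ v ∈ V,
      C * κ (s δ) * Metric.infDist δ (frontier M) ^ η ≤ Real.exp ⟪s δ, v⟫ := by
  classical
  have hVne : V.Nonempty := by
    rw [Finset.nonempty_iff_ne_empty]; rintro rfl; simp at hcsum
  have hκpos : ∀ x, 0 < κ x := fun x => by
    rw [hκ]; exact Finset.sum_pos (fun v hv => mul_pos (hc v hv) (Real.exp_pos _)) hVne
  choose KA hKA0 hKA using aux_K V
  set K : ℝ := 1 + ∑ A ∈ V.powerset, KA A with hK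
  have hsum0 : 0 ≤ ∑ A ∈ V.powerset, KA A := Finset.sum_nonneg fun A _ => hKA0 A
  have hK1 : 1 ≤ K := by linarith
  have hKpos : 0 < K := by linarith
  have hKlt : ∀ A ⊆ V, KA A < K := fun A hA => by
    have := Finset.single_le_sum (f := KA) (fun A _ => hKA0 A) (Finset.mem_powerset.2 hA)
    linarith
  obtain ⟨vm, hvm, hcm⟩ := Finset.exists_min_image V c hVne
  set cm := c vm with hcmdef
  have hcm0 : 0 < cm := hc vm hvm
  have hcm1 : cm ≤ 1 := by
    rw [← hcsum]; exact Finset.single_le_sum (fun v hv => (hc v hv).le) hvm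
  set D := Metric.diam (convexHull ℝ (V : Set E)) with hD
  have hbd : Bornology.IsBounded (convexHull ℝ (V : Set E)) :=
    isBounded_convexHull.2 V.finite_toSet.isBounded
  have hclosed : IsClosed (convexHull ℝ (V : Set E)) :=
    (V.finite_toSet.isCompact_convexHull ℝ).isClosed
  have hD0 : 0 ≤ D := Metric.diam_nonneg
  set B := D / cm + 1 with hB
  have hDB : D ≤ D / cm := by rw [le_div_iff₀ hcm0]; nlinarith
  have hB0 : 0 < B := by positivity
  have hMsub : M ⊆ convexHull ℝ (V : Set E) := hM ▸ interior_subset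
  refine ⟨K, hK1, (B ^ K)⁻¹, by positivity, fun δ hδ v hv => ?_⟩
  set x := s δ with hx
  set d := Metric.infDist δ (frontier M) with hd
  have hd0 : 0 ≤ d := Metric.infDist_nonneg
  have hdD : d ≤ D := by
    rcases (frontier M).eq_empty_or_nonempty with h | ⟨y, hy⟩
    · rw [hd, h]; simpa using hD0
    · refine (Metric.infDist_le_dist_of_mem hy).trans (Metric.dist_le_diam_of_mem hbd (hMsub hδ) ?_)
      exact closure_minimal hMsub hclosed (frontier_subset_closure hy)
  obtain ⟨t, ht, htmax⟩ := Finset.exists_max_image V (fun w => ⟪x, w⟫) hVne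
  set L := ⟪x, t⟫ - ⟪x, v⟫ with hL
  have hL0 : 0 ≤ L := by have := htmax v hv; linarith
  have hκle : κ x ≤ Real.exp ⟪x, t⟫ := by
    rw [hκ]
    calc _ ≤ ∑ w ∈ V, c w * Real.exp ⟪x, t⟫ := Finset.sum_le_sum fun w hw =>
          mul_le_mul_of_nonneg_left (Real.exp_le_exp.2 (htmax w hw)) (hc w hw).le
      _ = _ := by rw [← Finset.sum_mul, hcsum, one_mul]
  have hκge : cm * Real.exp ⟪x, t⟫ ≤ κ x := by
    rw [hκ]
    calc _ ≤ c t * Real.exp ⟪x, t⟫ := mul_le_mul_of_nonneg_right (hcm t ht) (Real.exp_pos _).le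
      _ ≤ _ := Finset.single_le_sum (f := fun w => c w * Real.exp ⟪x, w⟫)
        (fun w hw => (mul_pos (hc w hw) (Real.exp_pos _)).le) ht
  have key : d ≤ B * Real.exp (-(L / K)) := by
    rcases hL0.eq_or_lt with h0 | hLpos
    · rw [← h0]; simp; linarith
    set A := V.filter (fun w => ⟪x, t⟫ - ⟪x, w⟫ ≤ L / K) with hA
    have hAV : A ⊆ V := Finset.filter_subset _ _
    have htA : t ∈ A := by
      rw [hA, Finset.mem_filter]; refine ⟨ht, ?_⟩
      rw [sub_self]; positivity
    have hdisj : ∀ y ∈ convexHull ℝ (A : Set E), y ∉ M := by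
      intro y hy hyM
      have h := hKA A ⟨y, hy, hM ▸ hyM⟩ x v hv ⟪x, t⟫ (L / K) htmax
        (fun w hw => (Finset.mem_filter.1 hw).2)
      have h2 : KA A * (L / K) < K * (L / K) :=
        mul_lt_mul_of_pos_right (hKlt A hAV) (by positivity)
      rw [mul_div_cancel₀ _ hKpos.ne'] at h2
      linarith
    set p : E → ℝ := fun w => c w * Real.exp ⟪x, w⟫ / κ x with hp
    have hp0 : ∀ w ∈ V, 0 ≤ p w := fun w hw =>
      div_nonneg (mul_pos (hc w hw) (Real.exp_pos _)).le (hκpos x).le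
    have hp1 : ∑ w ∈ V, p w = 1 := by
      simp only [hp]
      rw [← Finset.sum_div, ← hκ, div_self (hκpos x).ne']
    have hδeq : δ = ∑ w ∈ V, p w • w := by
      rw [← aux_grad V c κ hκ x (hκpos x), hx, hs δ hδ]
    set g : E → E := fun w => if w ∈ A then w else t with hg
    have hyA : ∑ w ∈ V, p w • g w ∈ convexHull ℝ (A : Set E) := by
      refine (convex_convexHull ℝ _).sum_mem hp0 hp1 fun w hw => subset_convexHull ℝ _ ?_
      simp only [hg]; split_ifs with h
      · exact h
      · exact htA
    set y := ∑ w ∈ V, p w • g w with hy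
    have hyM := hdisj y hyA
    have hdy : d ≤ dist δ y := by
      obtain ⟨z, hz, hz2⟩ := exists_mem_frontier_infDist_compl_eq_dist hδ
        (fun h => hyM (h ▸ Set.mem_univ y))
      calc d ≤ dist δ z := Metric.infDist_le_dist_of_mem hz
        _ = Metric.infDist δ Mᶜ := hz2.symm
        _ ≤ dist δ y := Metric.infDist_le_dist_of_mem hyM
    have hterm : ∀ w ∈ V, ‖p w • w - p w • g w‖ ≤ c w * (D / cm * Real.exp (-(L / K))) := by
      intro w hw
      have hcw := hc w hw
      by_cases hwA : w ∈ A
      · simp only [hg, hwA, if_true, sub_self, norm_zero]; positivity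
      · simp only [hg, hwA, if_false]
        rw [← smul_sub, norm_smul, Real.norm_of_nonneg (hp0 w hw), ← dist_eq_norm]
        have h1 : dist w t ≤ D := Metric.dist_le_diam_of_mem hbd
          (subset_convexHull ℝ _ hw) (subset_convexHull ℝ _ ht)
        have h2 : p w ≤ c w / cm * Real.exp (-(L / K)) := by
          have h3 : L / K < ⟪x, t⟫ - ⟪x, w⟫ := by
            by_contra hcon
            exact hwA (Finset.mem_filter.2 ⟨hw, not_lt.1 hcon⟩)
          have h4 : Real.exp ⟪x, w⟫ ≤ Real.exp ⟪x, t⟫ * Real.exp (-(L / K)) := by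
            rw [← Real.exp_add]; exact Real.exp_le_exp.2 (by linarith)
          simp only [hp]
          rw [div_le_iff₀ (hκpos x)]
          calc c w * Real.exp ⟪x, w⟫ ≤ c w * (Real.exp ⟪x, t⟫ * Real.exp (-(L / K))) := by gcongr
            _ = c w / cm * Real.exp (-(L / K)) * (cm * Real.exp ⟪x, t⟫) := by field_simp
            _ ≤ _ := by gcongr
        calc p w * dist w t ≤ (c w / cm * Real.exp (-(L / K))) * D := by gcongr
          _ = _ := by ring
    have hdist : dist δ y ≤ D / cm * Real.exp (-(L / K)) := by
      rw [dist_eq_norm]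
      nth_rewrite 1 [hδeq]
      rw [hy, ← Finset.sum_sub_distrib]
      calc _ ≤ ∑ w ∈ V, c w * (D / cm * Real.exp (-(L / K))) :=
            norm_sum_le_of_le _ hterm
        _ = _ := by rw [← Finset.sum_mul, hcsum, one_mul]
    have := Real.exp_pos (-(L / K))
    rw [hB]; nlinarith
  have hdK : d ^ K ≤ B ^ K * Real.exp (-L) := by
    calc d ^ K ≤ (B * Real.exp (-(L / K))) ^ K := Real.rpow_le_rpow hd0 key hKpos.le
      _ = _ := by
        rw [Real.mul_rpow hB0.le (Real.exp_pos _).le, ← Real.exp_mul]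
        congr 2; field_simp
  have hBK : 0 < B ^ K := by positivity
  have := hκpos x
  calc (B ^ K)⁻¹ * κ x * d ^ K ≤ (B ^ K)⁻¹ * κ x * (B ^ K * Real.exp (-L)) := by gcongr
    _ = κ x * Real.exp (-L) := by field_simp
    _ ≤ Real.exp ⟪x, t⟫ * Real.exp (-L) := by gcongr
    _ = Real.exp ⟪x, v⟫ := by rw [← Real.exp_add]; congr 1; rw [hL]; ring
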